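/- Let (p, x, σ, β) be admissible parameters with z = p − Σ_{i=1}^{n−1} x_i²/σ_i > 0, and let R be the curvature operator of the inner product ⟨·,·⟩ = S(p, x, σ, β) on 𝔠𝔥(n). Then for all i, j ∈ {1,…,n−1}: R(Y_i, Y_j) = −(1/(4z))·Y_i∧Y_j − (β/(4σ_iσ_j))·Z_i∧Z_j as endomorphisms of 𝔠𝔥(n). -/

import Mathlib

noncomputable section

open Matrix BigOperators Finset

namespace CHn

/-- Structure constants of the Lie algebra 𝔠𝔥(n) in the ordered basis
`(X, Y_1, …, Y_{n-1}, Z_1, …, Z_{n-1}, W)`: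
index `0 ↦ X`, indices `1,…,n-1 ↦ Y_1,…,Y_{n-1}`,
indices `n,…,2n-2 ↦ Z_1,…,Z_{n-1}`, index `2n-1 ↦ W`.
The nonzero brackets are `[X,Y_i] = (1/2)Y_i`, `[X,Z_i] = (1/2)Z_i`,
`[X,W] = W`, `[Z_j,Y_i] = δ_{ij} W`. -/
def structC (n : ℕ) (i j k : Fin (2 * n)) : ℝ :=
  (if i.val = 0 ∧ j = k ∧ 1 ≤ j.val ∧ j.val ≤ 2 * n - 2 then (1 : ℝ) / 2 else 0)
  - (if j.val = 0 ∧ i = k ∧ 1 ≤ i.val ∧ i.val ≤ 2 * n - 2 then (1 : ℝ) / 2 else 0)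
  + (if i.val = 0 ∧ j.val = 2 * n - 1 ∧ k.val = 2 * n - 1 then (1 : ℝ) else 0)
  - (if j.val = 0 ∧ i.val = 2 * n - 1 ∧ k.val = 2 * n - 1 then (1 : ℝ) else 0)
  + (if n ≤ i.val ∧ i.val ≤ 2 * n - 2 ∧ i.val = j.val + (n - 1) ∧ k.val = 2 * n - 1
      then (1 : ℝ) else 0)
  - (if n ≤ j.val ∧ j.val ≤ 2 * n - 2 ∧ j.val = i.val + (n - 1) ∧ k.val = 2 * n - 1
      then (1 : ℝ) else 0)

/-- The Lie bracket of `𝔠𝔥(n)`, as a bilinear operation on coordinate vectors. -/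
def bracket (n : ℕ) (u v : Fin (2 * n) → ℝ) : Fin (2 * n) → ℝ :=
  fun k => ∑ i, ∑ j, u i * v j * structC n i j k

/-- `F` is the matrix (in the ordered basis) of a Lie algebra automorphism of `𝔠𝔥(n)`. -/
def IsAut (n : ℕ) (F : Matrix (Fin (2 * n)) (Fin (2 * n)) ℝ) : Prop :=
  IsUnit F ∧ ∀ u v, F.mulVec (bracket n u v) = bracket n (F.mulVec u) (F.mulVec v)

/-- The normal form `S(p, x, σ, β)`: the block matrix
`[[p, xᵀ, 0, 0], [x, σ, 0, 0], [0, 0, σ, 0], [0, 0, 0, β]]`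
with blocks of sizes `1, n-1, n-1, 1`. -/
def Sform (n : ℕ) (p : ℝ) (x σ : Fin (n - 1) → ℝ) (β : ℝ) :
    Matrix (Fin (2 * n)) (Fin (2 * n)) ℝ := fun i j =>
  if i.val = 0 ∧ j.val = 0 then p
  else if h : i.val = 0 ∧ 1 ≤ j.val ∧ j.val ≤ n - 1 then x ⟨j.val - 1, by omega⟩
  else if h : j.val = 0 ∧ 1 ≤ i.val ∧ i.val ≤ n - 1 then x ⟨i.val - 1, by omega⟩
  else if h : i = j ∧ 1 ≤ i.val ∧ i.val ≤ n - 1 then σ ⟨i.val - 1, by omega⟩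
  else if h : i = j ∧ n ≤ i.val ∧ i.val ≤ 2 * n - 2 then σ ⟨i.val - n, by omega⟩
  else if i = j ∧ i.val = 2 * n - 1 then β
  else 0

/-- Admissibility of the parameters `(p, x, σ, β)`:
`p, β > 0`, all `x_i ≥ 0`, `σ_1 ≥ … ≥ σ_{n-2} ≥ 1` and the convention `σ_{n-1} = 1`. -/
def Admissible (n : ℕ) (p : ℝ) (x σ : Fin (n - 1) → ℝ) (β : ℝ) : Prop :=
  0 < p ∧ 0 < β ∧ (∀ i, 0 ≤ x i) ∧ Antitone σ ∧ (∀ i, 1 ≤ σ i) ∧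
    ∀ _h : 1 ≤ n - 1, σ ⟨n - 2, by omega⟩ = 1

/-- `z = p - Σ_i x_i² / σ_i`. -/
def zval (n : ℕ) (p : ℝ) (x σ : Fin (n - 1) → ℝ) : ℝ :=
  p - ∑ i, (x i) ^ 2 / σ i

/-- The inner product on `𝔠𝔥(n)` determined by a matrix `S`. -/
def ip (n : ℕ) (S : Matrix (Fin (2 * n)) (Fin (2 * n)) ℝ) (u v : Fin (2 * n) → ℝ) : ℝ :=
  u ⬝ᵥ S.mulVec v

/-- The coordinates (w.r.t. the standard basis) of the Koszul form
`K(u,v)(T) = ⟨[u,v],T⟩ - ⟨[v,T],u⟩ + ⟨[T,u],v⟩`. -/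
def koszul (n : ℕ) (S : Matrix (Fin (2 * n)) (Fin (2 * n)) ℝ)
    (u v : Fin (2 * n) → ℝ) : Fin (2 * n) → ℝ := fun t =>
  ip n S (bracket n u v) (Pi.single t 1) - ip n S (bracket n v (Pi.single t 1)) u
    + ip n S (bracket n (Pi.single t 1) u) v

/-- The Levi-Civita product `∇_u v` of the inner product `S`,
i.e. the unique solution of the Koszul formula `2⟨∇_u v, T⟩ = K(u,v)(T)`
(for invertible symmetric `S`). -/
def nabla (n : ℕ) (S : Matrix (Fin (2 * n)) (Fin (2 * n)) ℝ)
    (u v : Fin (2 * n) → ℝ) : Fin (2 * n) → ℝ :=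
  (2 : ℝ)⁻¹ • (S⁻¹).mulVec (koszul n S u v)

/-- The curvature operator `R(u,v)w = ∇_u∇_v w - ∇_v∇_u w - ∇_{[u,v]} w`. -/
def curv (n : ℕ) (S : Matrix (Fin (2 * n)) (Fin (2 * n)) ℝ)
    (u v w : Fin (2 * n) → ℝ) : Fin (2 * n) → ℝ :=
  nabla n S u (nabla n S v w) - nabla n S v (nabla n S u w) - nabla n S (bracket n u v) w

/-- The Ricci form `Ric(u,v) = tr (T ↦ R(T,u)v)`. -/
def ricci (n : ℕ) (S : Matrix (Fin (2 * n)) (Fin (2 * n)) ℝ)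
    (u v : Fin (2 * n) → ℝ) : ℝ :=
  ∑ t, curv n S (Pi.single t 1) u v t

/-- The scalar curvature `τ = Σ_{i,j} g^{ij} Ric(e_i, e_j)`. -/
def scalarCurv (n : ℕ) (S : Matrix (Fin (2 * n)) (Fin (2 * n)) ℝ) : ℝ :=
  ∑ i, ∑ j, (S⁻¹) i j * ricci n S (Pi.single i 1) (Pi.single j 1)

/-- The wedge endomorphism `(u∧v)(w) = ⟨v,w⟩u - ⟨u,w⟩v`. -/
def wedge (n : ℕ) (S : Matrix (Fin (2 * n)) (Fin (2 * n)) ℝ)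
    (u v : Fin (2 * n) → ℝ) : (Fin (2 * n) → ℝ) → (Fin (2 * n) → ℝ) :=
  fun w => ip n S v w • u - ip n S u w • v

/-- The standard symplectic matrix `J_m = [[0, I_m], [-I_m, 0]]`. -/
def Jmat (m : ℕ) : Matrix (Fin (2 * m)) (Fin (2 * m)) ℝ := fun i j =>
  if j.val = i.val + m then 1 else if i.val = j.val + m then -1 else 0

/-- The block matrix `[[1, 0, 0], [u, M, 0], [a, vᵀ, λ]]`
with blocks of sizes `1, 2n-2, 1`. -/
def blockF (n : ℕ) (M : Matrix (Fin (2 * (n - 1))) (Fin (2 * (n - 1))) ℝ)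
    (u v : Fin (2 * (n - 1)) → ℝ) (a lam : ℝ) :
    Matrix (Fin (2 * n)) (Fin (2 * n)) ℝ := fun i j =>
  if i.val = 0 then (if j.val = 0 then 1 else 0)
  else if h : 1 ≤ i.val ∧ i.val ≤ 2 * n - 2 then
    (if j.val = 0 then u ⟨i.val - 1, by omega⟩
     else if h2 : 1 ≤ j.val ∧ j.val ≤ 2 * n - 2 then
       M ⟨i.val - 1, by omega⟩ ⟨j.val - 1, by omega⟩
     else 0)
  else
    (if j.val = 0 then a
     else if h2 : 1 ≤ j.val ∧ j.val ≤ 2 * n - 2 then v ⟨j.val - 1, by omega⟩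
     else lam)

/-- The metric is Einstein: the Ricci form is proportional to the inner product. -/
def IsEinstein (n : ℕ) (S : Matrix (Fin (2 * n)) (Fin (2 * n)) ℝ) : Prop :=
  ∃ c : ℝ, ∀ u v, ricci n S u v = c * ip n S u v

end CHn
set_option linter.unusedSimpArgs false
namespace CHn

def iX (n : ℕ) (hn : 2 ≤ n) : Fin (2 * n) := ⟨0, by omega⟩
def iY (n : ℕ) (i : Fin (n - 1)) : Fin (2 * n) := ⟨i.val + 1, by have := i.isLt; omega⟩
def iZ (n : ℕ) (i : Fin (n - 1)) : Fin (2 * n) := ⟨i.val + n, by have := i.isLt; omega⟩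
def iW (n : ℕ) (hn : 2 ≤ n) : Fin (2 * n) := ⟨2 * n - 1, by omega⟩

def idx (n : ℕ) (hn : 2 ≤ n) : Unit ⊕ Fin (n - 1) ⊕ Fin (n - 1) ⊕ Unit → Fin (2 * n)
  | .inl _ => iX n hn
  | .inr (.inl i) => iY n i
  | .inr (.inr (.inl i)) => iZ n i
  | .inr (.inr (.inr _)) => iW n hn

theorem idx_bij (n : ℕ) (hn : 2 ≤ n) : Function.Bijective (idx n hn) := by
  constructor
  · rintro (_ | i | i | _) (_ | j | j | _) h <;>
      simp only [idx, iX, iY, iZ, iW, Fin.mk.injEq] at h <;>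
      first
        | rfl
        | (exfalso; omega)
        | (congr; omega)
        | (have : i = j := Fin.ext (by omega)
           rw [this])
  · intro k
    have hk := k.isLt
    by_cases h0 : k.val = 0
    · exact ⟨.inl (), Fin.ext (by simp [idx, iX, h0])⟩
    by_cases h1 : k.val ≤ n - 1
    · exact ⟨.inr (.inl ⟨k.val - 1, by omega⟩), Fin.ext (by simp [idx, iY]; omega)⟩
    by_cases h2 : k.val ≤ 2 * n - 2
    · exact ⟨.inr (.inr (.inl ⟨k.val - n, by omega⟩)), Fin.ext (by simp [idx, iZ]; omega)⟩
    · exact ⟨.inr (.inr (.inr ())), Fin.ext (by simp [idx, iW]; omega)⟩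

theorem sum_idx (n : ℕ) (hn : 2 ≤ n) (f : Fin (2 * n) → ℝ) :
    ∑ k, f k = f (iX n hn) + ((∑ i, f (iY n i)) + ((∑ i, f (iZ n i)) + f (iW n hn))) := by
  rw [← Function.Bijective.sum_comp (idx_bij n hn) f]
  simp [idx]

theorem ext_idx (n : ℕ) (hn : 2 ≤ n) (u v : Fin (2 * n) → ℝ)
    (hX : u (iX n hn) = v (iX n hn)) (hY : ∀ i, u (iY n i) = v (iY n i))
    (hZ : ∀ i, u (iZ n i) = v (iZ n i)) (hW : u (iW n hn) = v (iW n hn)) : u = v := by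
  funext k
  obtain ⟨s, rfl⟩ := (idx_bij n hn).2 k
  rcases s with _ | i | i | _
  · exact hX
  · exact hY i
  · exact hZ i
  · exact hW

section
variable (n : ℕ) (hn : 2 ≤ n) (i j : Fin (n - 1))

theorem YX : (iY n i = iX n hn) = False := by simp [iX, iY]
theorem XY : (iX n hn = iY n i) = False := by simp [iX, iY]
theorem ZX : (iZ n i = iX n hn) = False := by simp [iX, iZ]; omega
theorem XZ : (iX n hn = iZ n i) = False := by simp [iX, iZ]; omega
theorem WX : (iW n hn = iX n hn) = False := by simp [iX, iW]; omega
theorem XW : (iX n hn = iW n hn) = False := by simp [iX, iW]; omega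
theorem YZ : (iY n i = iZ n j) = False := by simp [iY, iZ]; omega
theorem ZY : (iZ n i = iY n j) = False := by simp [iY, iZ]; omega
theorem YW : (iY n i = iW n hn) = False := by simp [iY, iW]; omega
theorem WY : (iW n hn = iY n i) = False := by simp [iY, iW]; omega
theorem ZW : (iZ n i = iW n hn) = False := by simp [iZ, iW]; omega
theorem WZ : (iW n hn = iZ n i) = False := by simp [iZ, iW]; omega
theorem YY : (iY n i = iY n j) = (i = j) := by simp [iY, Fin.ext_iff]
theorem ZZ : (iZ n i = iZ n j) = (i = j) := by simp [iZ, Fin.ext_iff]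

end

theorem sc_X (n : ℕ) (hn : 2 ≤ n) (i j : Fin (2 * n)) : structC n i j (iX n hn) = 0 := by
  have hk : (iX n hn).val = 0 := rfl
  have hi : i = iX n hn → i.val = 0 := fun h => by rw [h, hk]
  have hj : j = iX n hn → j.val = 0 := fun h => by rw [h, hk]
  rw [structC, if_neg (by rintro ⟨_, h, _⟩; have := hj h; omega),
    if_neg (by rintro ⟨_, h, _⟩; have := hi h; omega),
    if_neg (by omega), if_neg (by omega), if_neg (by omega), if_neg (by omega)]
  norm_num

theorem sc_Y (n : ℕ) (hn : 2 ≤ n) (i j : Fin (2 * n)) (l : Fin (n - 1)) :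
    structC n i j (iY n l) = (if i = iX n hn then if j = iY n l then 1 / 2 else 0 else 0)
      - (if j = iX n hn then if i = iY n l then 1 / 2 else 0 else 0) := by
  have := l.isLt
  have hk : (iY n l).val = l.val + 1 := rfl
  have h0 : (iX n hn).val = 0 := rfl
  simp only [structC, ← ite_and]
  rw [if_neg (c := _ ∧ _ ∧ _ = 2 * n - 1) (by omega), if_neg (c := _ ∧ _ ∧ _ = 2 * n - 1) (by omega),
    if_neg (c := n ≤ _ ∧ _) (by omega), if_neg (c := n ≤ _ ∧ _) (by omega)]
  simp only [sub_zero, add_zero]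
  congr 1 <;> apply if_congr _ rfl rfl <;> simp only [Fin.ext_iff, hk, h0] <;> omega

theorem sc_Z (n : ℕ) (hn : 2 ≤ n) (i j : Fin (2 * n)) (l : Fin (n - 1)) :
    structC n i j (iZ n l) = (if i = iX n hn then if j = iZ n l then 1 / 2 else 0 else 0)
      - (if j = iX n hn then if i = iZ n l then 1 / 2 else 0 else 0) := by
  have := l.isLt
  have hk : (iZ n l).val = l.val + n := rfl
  have h0 : (iX n hn).val = 0 := rfl
  simp only [structC, ← ite_and]
  rw [if_neg (c := _ ∧ _ ∧ _ = 2 * n - 1) (by omega), if_neg (c := _ ∧ _ ∧ _ = 2 * n - 1) (by omega),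
    if_neg (c := n ≤ _ ∧ _) (by omega), if_neg (c := n ≤ _ ∧ _) (by omega)]
  simp only [sub_zero, add_zero]
  congr 1 <;> apply if_congr _ rfl rfl <;> simp only [Fin.ext_iff, hk, h0] <;> omega

theorem sc_W (n : ℕ) (hn : 2 ≤ n) (i j : Fin (2 * n)) :
    structC n i j (iW n hn) = (if i = iX n hn then if j = iW n hn then 1 else 0 else 0)
      - (if j = iX n hn then if i = iW n hn then 1 else 0 else 0)
      + ∑ l, (if i = iZ n l then if j = iY n l then 1 else 0 else 0)
      - ∑ l, (if j = iZ n l then if i = iY n l then 1 else 0 else 0) := by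
  have key : ∀ i j : Fin (2 * n), (if n ≤ i.val ∧ i.val ≤ 2 * n - 2 ∧ i.val = j.val + (n - 1)
      then (1 : ℝ) else 0) = ∑ l, (if i = iZ n l then if j = iY n l then 1 else 0 else 0) := by
    intro i j
    split_ifs with h
    · rw [Finset.sum_eq_single (⟨i.val - n, by omega⟩ : Fin (n - 1))]
      · rw [if_pos, if_pos] <;> simp [iY, iZ, Fin.ext_iff] <;> omega
      · intro b _ hb
        rw [if_neg]
        intro h'
        apply hb
        simp [iZ, Fin.ext_iff] at h' ⊢
        omega
      · simp
    · symm
      apply Finset.sum_eq_zero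
      intro l _
      have := l.isLt
      simp only [iY, iZ, Fin.ext_iff, ← ite_and]
      rw [if_neg]
      omega
  rw [← key, ← key]
  simp only [structC, iX, iW, Fin.ext_iff, ← ite_and]
  rw [if_neg (c := _ ∧ _ ∧ 1 ≤ _ ∧ _) (by omega), if_neg (c := _ ∧ _ ∧ 1 ≤ _ ∧ _) (by omega)]
  simp

theorem br_X (n : ℕ) (hn : 2 ≤ n) (u v : Fin (2 * n) → ℝ) : bracket n u v (iX n hn) = 0 := by
  simp [bracket, sc_X]

theorem br_Y (n : ℕ) (hn : 2 ≤ n) (u v : Fin (2 * n) → ℝ) (l) :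
    bracket n u v (iY n l) = (u (iX n hn) * v (iY n l) - v (iX n hn) * u (iY n l)) / 2 := by
  simp only [bracket, sc_Y n hn, mul_sub, Finset.sum_sub_distrib]
  simp
  ring

theorem br_Z (n : ℕ) (hn : 2 ≤ n) (u v : Fin (2 * n) → ℝ) (l) :
    bracket n u v (iZ n l) = (u (iX n hn) * v (iZ n l) - v (iX n hn) * u (iZ n l)) / 2 := by
  simp only [bracket, sc_Z n hn, mul_sub, Finset.sum_sub_distrib]
  simp
  ring

theorem br_W (n : ℕ) (hn : 2 ≤ n) (u v : Fin (2 * n) → ℝ) :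
    bracket n u v (iW n hn) = u (iX n hn) * v (iW n hn) - v (iX n hn) * u (iW n hn)
      + ∑ l, u (iZ n l) * v (iY n l) - ∑ l, v (iZ n l) * u (iY n l) := by
  have key : ∀ u v : Fin (2 * n) → ℝ, ∑ i, ∑ j, u i * v j *
      (∑ l, (if i = iZ n l then if j = iY n l then (1 : ℝ) else 0 else 0))
      = ∑ l, u (iZ n l) * v (iY n l) := by
    intro u v
    simp only [Finset.mul_sum]
    simp only [Finset.sum_comm (t := (Finset.univ : Finset (Fin (n - 1))))]
    apply Finset.sum_congr rfl
    intro l _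
    simp
  simp only [bracket, sc_W n hn, mul_sub, mul_add, Finset.sum_sub_distrib, Finset.sum_add_distrib]
  rw [key, Finset.sum_comm (f := fun i j => u i * v j * ∑ l, (if j = iZ n l then if i = iY n l then (1 : ℝ) else 0 else 0))]
  simp only [mul_comm (u _) (v _)]
  rw [key]
  simp

theorem SXX {n : ℕ} (hn : 2 ≤ n) {p β : ℝ} {x σ : Fin (n - 1) → ℝ} :
    Sform n p x σ β (iX n hn) (iX n hn) = p := by
  simp [Sform, iX]

theorem SXY {n : ℕ} (hn : 2 ≤ n) {p β : ℝ} {x σ : Fin (n - 1) → ℝ} :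
    ∀ i, Sform n p x σ β (iX n hn) (iY n i) = x i := by
  intro i
  have := i.isLt
  simp [Sform, iX, iY]
  try omega

theorem SXZ {n : ℕ} (hn : 2 ≤ n) {p β : ℝ} {x σ : Fin (n - 1) → ℝ} :
    ∀ i, Sform n p x σ β (iX n hn) (iZ n i) = 0 := by
  intro i
  have := i.isLt
  have h0 : (iX n hn).val = 0 := rfl
  have h1 : (iZ n i).val = i.val + n := rfl
  have hne : (iX n hn) ≠ (iZ n i) := fun h => by have := congrArg Fin.val h; omega
  rw [Sform, if_neg (by omega), dif_neg (by omega), dif_neg (by omega), dif_neg (by tauto),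
    dif_neg (by tauto), if_neg (by tauto)]

theorem SXW {n : ℕ} (hn : 2 ≤ n) {p β : ℝ} {x σ : Fin (n - 1) → ℝ} :
    Sform n p x σ β (iX n hn) (iW n hn) = 0 := by
  have h0 : (iX n hn).val = 0 := rfl
  have h1 : (iW n hn).val = 2 * n - 1 := rfl
  have hne : (iX n hn) ≠ (iW n hn) := fun h => by have := congrArg Fin.val h; omega
  rw [Sform, if_neg (by omega), dif_neg (by omega), dif_neg (by omega), dif_neg (by tauto),
    dif_neg (by tauto), if_neg (by tauto)]

theorem SYX {n : ℕ} (hn : 2 ≤ n) {p β : ℝ} {x σ : Fin (n - 1) → ℝ} :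
    ∀ i, Sform n p x σ β (iY n i) (iX n hn) = x i := by
  intro i
  have := i.isLt
  simp [Sform, iX, iY]
  try omega

theorem SZX {n : ℕ} (hn : 2 ≤ n) {p β : ℝ} {x σ : Fin (n - 1) → ℝ} :
    ∀ i, Sform n p x σ β (iZ n i) (iX n hn) = 0 := by
  intro i
  have := i.isLt
  have h0 : (iZ n i).val = i.val + n := rfl
  have h1 : (iX n hn).val = 0 := rfl
  have hne : (iZ n i) ≠ (iX n hn) := fun h => by have := congrArg Fin.val h; omega
  rw [Sform, if_neg (by omega), dif_neg (by omega), dif_neg (by omega), dif_neg (by tauto),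
    dif_neg (by tauto), if_neg (by tauto)]

theorem SWX {n : ℕ} (hn : 2 ≤ n) {p β : ℝ} {x σ : Fin (n - 1) → ℝ} :
    Sform n p x σ β (iW n hn) (iX n hn) = 0 := by
  have h0 : (iW n hn).val = 2 * n - 1 := rfl
  have h1 : (iX n hn).val = 0 := rfl
  have hne : (iW n hn) ≠ (iX n hn) := fun h => by have := congrArg Fin.val h; omega
  rw [Sform, if_neg (by omega), dif_neg (by omega), dif_neg (by omega), dif_neg (by tauto),
    dif_neg (by tauto), if_neg (by tauto)]

theorem SYY {n : ℕ} (hn : 2 ≤ n) {p β : ℝ} {x σ : Fin (n - 1) → ℝ} :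
    ∀ i j, Sform n p x σ β (iY n i) (iY n j) = if i = j then σ i else 0 := by
  intro i j
  have := i.isLt
  have := j.isLt
  by_cases h : i = j
  · subst h
    simp [Sform, iY]
    try omega
  · have : i.val ≠ j.val := fun h' => h (Fin.ext h')
    simp [Sform, iY, Fin.ext_iff, this]

theorem SZZ {n : ℕ} (hn : 2 ≤ n) {p β : ℝ} {x σ : Fin (n - 1) → ℝ} :
    ∀ i j, Sform n p x σ β (iZ n i) (iZ n j) = if i = j then σ i else 0 := by
  intro i j
  have := i.isLt
  have := j.isLt
  have hi : (iZ n i).val = i.val + n := rfl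
  have hj : (iZ n j).val = j.val + n := rfl
  by_cases h : i = j
  · subst h
    rw [Sform, if_neg (by omega), dif_neg (by omega), dif_neg (by omega), dif_neg (by omega),
      dif_pos ⟨rfl, by omega, by omega⟩, if_pos rfl]
    congr 1
    ext
    simp [hi]
  · have : iZ n i ≠ iZ n j := by rw [Ne, ZZ]; exact h
    rw [Sform, if_neg (by omega), dif_neg (by omega), dif_neg (by omega), dif_neg (by tauto),
      dif_neg (by tauto), if_neg (by tauto), if_neg h]

theorem SWW {n : ℕ} (hn : 2 ≤ n) {p β : ℝ} {x σ : Fin (n - 1) → ℝ} :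
    Sform n p x σ β (iW n hn) (iW n hn) = β := by
  have hi : (iW n hn).val = 2 * n - 1 := rfl
  rw [Sform, if_neg (by omega), dif_neg (by omega), dif_neg (by omega), dif_neg (by omega),
    dif_neg (by omega), if_pos ⟨rfl, hi⟩]

theorem SYZ {n : ℕ} (hn : 2 ≤ n) {p β : ℝ} {x σ : Fin (n - 1) → ℝ} :
    ∀ i j, Sform n p x σ β (iY n i) (iZ n j) = 0 := by
  intro i j
  have := i.isLt
  have := j.isLt
  have h0 : (iY n i).val = i.val + 1 := rfl
  have h1 : (iZ n j).val = j.val + n := rfl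
  have hne : (iY n i) ≠ (iZ n j) := fun h => by have := congrArg Fin.val h; omega
  rw [Sform, if_neg (by omega), dif_neg (by omega), dif_neg (by omega), dif_neg (by tauto),
    dif_neg (by tauto), if_neg (by tauto)]

theorem SZY {n : ℕ} (hn : 2 ≤ n) {p β : ℝ} {x σ : Fin (n - 1) → ℝ} :
    ∀ i j, Sform n p x σ β (iZ n i) (iY n j) = 0 := by
  intro i j
  have := i.isLt
  have := j.isLt
  have h0 : (iZ n i).val = i.val + n := rfl
  have h1 : (iY n j).val = j.val + 1 := rfl
  have hne : (iZ n i) ≠ (iY n j) := fun h => by have := congrArg Fin.val h; omega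
  rw [Sform, if_neg (by omega), dif_neg (by omega), dif_neg (by omega), dif_neg (by tauto),
    dif_neg (by tauto), if_neg (by tauto)]

theorem SYW {n : ℕ} (hn : 2 ≤ n) {p β : ℝ} {x σ : Fin (n - 1) → ℝ} :
    ∀ i, Sform n p x σ β (iY n i) (iW n hn) = 0 := by
  intro i
  have := i.isLt
  have h0 : (iY n i).val = i.val + 1 := rfl
  have h1 : (iW n hn).val = 2 * n - 1 := rfl
  have hne : (iY n i) ≠ (iW n hn) := fun h => by have := congrArg Fin.val h; omega
  rw [Sform, if_neg (by omega), dif_neg (by omega), dif_neg (by omega), dif_neg (by tauto),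
    dif_neg (by tauto), if_neg (by tauto)]

theorem SWY {n : ℕ} (hn : 2 ≤ n) {p β : ℝ} {x σ : Fin (n - 1) → ℝ} :
    ∀ i, Sform n p x σ β (iW n hn) (iY n i) = 0 := by
  intro i
  have := i.isLt
  have h0 : (iW n hn).val = 2 * n - 1 := rfl
  have h1 : (iY n i).val = i.val + 1 := rfl
  have hne : (iW n hn) ≠ (iY n i) := fun h => by have := congrArg Fin.val h; omega
  rw [Sform, if_neg (by omega), dif_neg (by omega), dif_neg (by omega), dif_neg (by tauto),
    dif_neg (by tauto), if_neg (by tauto)]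

theorem SZW {n : ℕ} (hn : 2 ≤ n) {p β : ℝ} {x σ : Fin (n - 1) → ℝ} :
    ∀ i, Sform n p x σ β (iZ n i) (iW n hn) = 0 := by
  intro i
  have := i.isLt
  have h0 : (iZ n i).val = i.val + n := rfl
  have h1 : (iW n hn).val = 2 * n - 1 := rfl
  have hne : (iZ n i) ≠ (iW n hn) := fun h => by have := congrArg Fin.val h; omega
  rw [Sform, if_neg (by omega), dif_neg (by omega), dif_neg (by omega), dif_neg (by tauto),
    dif_neg (by tauto), if_neg (by tauto)]

theorem SWZ {n : ℕ} (hn : 2 ≤ n) {p β : ℝ} {x σ : Fin (n - 1) → ℝ} :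
    ∀ i, Sform n p x σ β (iW n hn) (iZ n i) = 0 := by
  intro i
  have := i.isLt
  have h0 : (iW n hn).val = 2 * n - 1 := rfl
  have h1 : (iZ n i).val = i.val + n := rfl
  have hne : (iW n hn) ≠ (iZ n i) := fun h => by have := congrArg Fin.val h; omega
  rw [Sform, if_neg (by omega), dif_neg (by omega), dif_neg (by omega), dif_neg (by tauto),
    dif_neg (by tauto), if_neg (by tauto)]

theorem ip_eq (n : ℕ) (hn : 2 ≤ n) (p β : ℝ) (x σ : Fin (n - 1) → ℝ) (u v : Fin (2 * n) → ℝ) :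
    ip n (Sform n p x σ β) u v = p * u (iX n hn) * v (iX n hn)
      + u (iX n hn) * ∑ l, x l * v (iY n l) + v (iX n hn) * ∑ l, x l * u (iY n l)
      + ∑ l, σ l * (u (iY n l) * v (iY n l)) + ∑ l, σ l * (u (iZ n l) * v (iZ n l))
      + β * u (iW n hn) * v (iW n hn) := by
  simp only [ip, dotProduct, mulVec, sum_idx n hn, SXX hn, SXY hn, SXZ hn, SXW hn, SYX hn, SYY hn, SYZ hn, SYW hn, SZX hn,
    SZY hn, SZZ hn, SZW hn, SWX hn, SWY hn, SWZ hn, SWW hn]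
  simp [Finset.mul_sum, mul_add, Finset.sum_add_distrib]
  have e1 : ∀ l, u (iY n l) * (x l * v (iX n hn)) = v (iX n hn) * (x l * u (iY n l)) := by
    intro l; ring
  have e2 : ∀ l, u (iY n l) * (σ l * v (iY n l)) = σ l * (u (iY n l) * v (iY n l)) := by
    intro l; ring
  have e3 : ∀ l, u (iZ n l) * (σ l * v (iZ n l)) = σ l * (u (iZ n l) * v (iZ n l)) := by
    intro l; ring
  simp only [e1, e2, e3]
  ring

/-- `∇_{Y_i} w`, explicitly. -/
noncomputable def nab (n : ℕ) (hn : 2 ≤ n) (z β : ℝ) (x σ : Fin (n - 1) → ℝ) (i : Fin (n - 1))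
    (w : Fin (2 * n) → ℝ) : Unit ⊕ Fin (n - 1) ⊕ Fin (n - 1) ⊕ Unit → ℝ
  | .inl _ => (x i * w (iX n hn) + σ i * w (iY n i)) / z / 2
  | .inr (.inl l) => (-(w (iX n hn) * if l = i then 1 else 0)
      - x l / σ l * ((x i * w (iX n hn) + σ i * w (iY n i)) / z)) / 2
  | .inr (.inr (.inl l)) => (β * w (iW n hn) / σ i * if l = i then 1 else 0) / 2
  | .inr (.inr (.inr _)) => -w (iZ n i) / 2

theorem Sform_isUnit (n : ℕ) (hn : 2 ≤ n) (p β : ℝ) (x σ : Fin (n - 1) → ℝ)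
    (hβ : 0 < β) (hσ : ∀ i, 0 < σ i) (hz : 0 < zval n p x σ) :
    IsUnit (Sform n p x σ β).det := by
  rw [isUnit_iff_ne_zero]
  intro h
  obtain ⟨v, hv, hv0⟩ := Matrix.exists_mulVec_eq_zero_iff.2 h
  have H : ∀ u, ip n (Sform n p x σ β) u v = 0 := by intro u; simp [ip, hv0]
  apply hv
  have hY : ∀ i, x i * v (iX n hn) + σ i * v (iY n i) = 0 := by
    intro i
    have := H (Pi.single (iY n i) 1)
    rw [ip_eq n hn] at this
    simp [Pi.single_apply, XY, ZX, XZ, WX, XW, YZ, ZY, YW, WY, ZW, WZ, YY, ZZ] at this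
    linarith
  have hY' : ∀ i, v (iY n i) = - (x i / σ i) * v (iX n hn) := by
    intro i
    have := hY i
    have := (hσ i).ne'
    field_simp
    linarith
  have hX : v (iX n hn) = 0 := by
    have := H (Pi.single (iX n hn) 1)
    rw [ip_eq n hn] at this
    simp [Pi.single_apply, YX, ZX, XZ, WX, XW, YZ, ZY, YW, WY, ZW, WZ, YY, ZZ] at this
    have e : ∑ l, x l * v (iY n l) = - (∑ l, x l ^ 2 / σ l) * v (iX n hn) := by
      rw [← Finset.sum_neg_distrib, Finset.sum_mul]
      apply Finset.sum_congr rfl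
      intro l _
      rw [hY']; ring
    rw [e] at this
    have h2 : zval n p x σ * v (iX n hn) = 0 := by rw [zval]; linarith
    exact (mul_eq_zero.1 h2).resolve_left hz.ne'
  apply ext_idx n hn
  · simpa using hX
  · intro i; rw [hY', hX]; simp
  · intro i
    have := H (Pi.single (iZ n i) 1)
    rw [ip_eq n hn] at this
    simpa [Pi.single_apply, YX, XY, XZ, WX, XW, YZ, ZY, YW, WY, ZW, WZ, YY, ZZ, (hσ i).ne'] using this
  · have := H (Pi.single (iW n hn) 1)
    rw [ip_eq n hn] at this
    simpa [Pi.single_apply, YX, XY, ZX, XZ, XW, YZ, ZY, YW, WY, ZW, WZ, YY, ZZ, hβ.ne'] using this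

theorem nabla_eq (n : ℕ) (hn : 2 ≤ n) (p β : ℝ) (x σ : Fin (n - 1) → ℝ)
    (hβ : 0 < β) (hσ : ∀ i, 0 < σ i) (hz : 0 < zval n p x σ) (i : Fin (n - 1))
    (w D : Fin (2 * n) → ℝ)
    (hD : ∀ s, D (idx n hn s) = nab n hn (zval n p x σ) β x σ i w s) :
    nabla n (Sform n p x σ β) (Pi.single (iY n i) 1) w = D := by
  have hX : D (iX n hn) = _ := hD (.inl ())
  have hY : ∀ l, D (iY n l) = _ := fun l => hD (.inr (.inl l))
  have hZ : ∀ l, D (iZ n l) = _ := fun l => hD (.inr (.inr (.inl l)))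
  have hW : D (iW n hn) = _ := hD (.inr (.inr (.inr ())))
  simp only [nab] at hX hY hZ hW
  have hmain : koszul n (Sform n p x σ β) (Pi.single (iY n i) 1) w
      = (Sform n p x σ β).mulVec ((2 : ℝ) • D) := by
    have hr : ∀ t, (Sform n p x σ β).mulVec ((2 : ℝ) • D) t
        = ip n (Sform n p x σ β) (Pi.single t 1) ((2 : ℝ) • D) := by intro t; simp [ip]
    have hz' := hz.ne'
    have hσi := (hσ i).ne'
    apply ext_idx n hn
    · rw [hr]
      simp only [koszul, ip_eq n hn, br_X, br_Y n hn, br_Z n hn, br_W]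
      simp [Pi.single_apply, YX, XY, ZX, XZ, WX, XW, YZ, ZY, YW, WY, ZW, WZ, YY, ZZ]
      have e : ∑ l, x l * (2 * D (iY n l)) = -(x i * w (iX n hn))
          - (∑ l, x l ^ 2 / σ l) * ((x i * w (iX n hn) + σ i * w (iY n i)) / zval n p x σ) := by
        have e1 : ∀ l, x l * (2 * D (iY n l)) = -(if l = i then x l * w (iX n hn) else 0)
            - x l ^ 2 / σ l * ((x i * w (iX n hn) + σ i * w (iY n i)) / zval n p x σ) := by
          intro l
          rw [hY]
          split_ifs <;> ring
        simp only [e1, Finset.sum_sub_distrib, Finset.sum_neg_distrib, ← Finset.sum_mul]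
        simp
      have hzz : ∑ l, x l ^ 2 / σ l = p - zval n p x σ := by rw [zval]; ring
      have f1 : ∑ l, x l * ((-if l = i then w (iX n hn) else 0) / 2) = -(x i * w (iX n hn)) / 2 := by
        rw [Finset.sum_eq_single i (fun b _ hb => by simp [hb]) (by simp)]
        simp; ring
      have f2 : ∑ l, x l * ((if l = i then (1 : ℝ) else 0) / 2) = x i / 2 := by
        rw [Finset.sum_eq_single i (fun b _ hb => by simp [hb]) (by simp)]
        simp; ring
      have f3 : ∑ l, σ l * ((if l = i then (1 : ℝ) else 0) / 2 * w (iY n l)) = σ i * w (iY n i) / 2 := by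
        rw [Finset.sum_eq_single i (fun b _ hb => by simp [hb]) (by simp)]
        simp; ring
      rw [e, hX, hzz, f1, f2, f3]
      field_simp
      ring
    · intro l
      have hσl := (hσ l).ne'
      rw [hr]
      simp only [koszul, ip_eq n hn, br_X, br_Y n hn, br_Z n hn, br_W]
      simp [Pi.single_apply, YX, XY, ZX, XZ, WX, XW, YZ, ZY, YW, WY, ZW, WZ, YY, ZZ, hX, hY]
      by_cases hli : l = i
      · subst hli
        simp
        try (field_simp; try ring)
      · have hil : i ≠ l := fun h => hli h.symm
        simp [hli, hil]
        try (field_simp; try ring)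
    · intro l
      rw [hr]
      simp only [koszul, ip_eq n hn, br_X, br_Y n hn, br_Z n hn, br_W]
      simp [Pi.single_apply, YX, XY, ZX, XZ, WX, XW, YZ, ZY, YW, WY, ZW, WZ, YY, ZZ, hZ]
      by_cases hli : l = i
      · subst hli
        simp
        try (field_simp; try ring)
      · have hil : i ≠ l := fun h => hli h.symm
        simp [hli, hil]
        try (field_simp; try ring)
    · rw [hr]
      simp only [koszul, ip_eq n hn, br_X, br_Y n hn, br_Z n hn, br_W]
      simp [Pi.single_apply, YX, XY, ZX, XZ, WX, XW, YZ, ZY, YW, WY, ZW, WZ, YY, ZZ, hW]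
      ring
  rw [nabla, hmain, Matrix.mulVec_mulVec,
    Matrix.nonsing_inv_mul _ (Sform_isUnit n hn p β x σ hβ hσ hz), Matrix.one_mulVec, smul_smul]
  norm_num



/-- `R(Y_i, Y_j) = -(1/(4z)) Y_i∧Y_j - (β/(4σ_iσ_j)) Z_i∧Z_j`. -/
theorem curv_Y_Y (n : ℕ) (hn : 2 ≤ n) (p β : ℝ) (x σ : Fin (n - 1) → ℝ)
    (hadm : Admissible n p x σ β) (hz : 0 < zval n p x σ) :
    let S := Sform n p x σ β
    let z := zval n p x σ
    let Y : Fin (n - 1) → Fin (2 * n) → ℝ :=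
      fun i => Pi.single ⟨i.val + 1, by have := i.isLt; omega⟩ 1
    let Z : Fin (n - 1) → Fin (2 * n) → ℝ :=
      fun i => Pi.single ⟨i.val + n, by have := i.isLt; omega⟩ 1
    ∀ i j, curv n S (Y i) (Y j)
      = (-(1 / (4 * z))) • wedge n S (Y i) (Y j)
        - (β / (4 * σ i * σ j)) • wedge n S (Z i) (Z j) := by

  intro S z Y Z i j
  obtain ⟨hp, hβ, -, -, hσ1, -⟩ := hadm
  have hσ : ∀ i, 0 < σ i := fun i => lt_of_lt_of_le one_pos (hσ1 i)
  have hσi := (hσ i).ne'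
  have hσj := (hσ j).ne'
  have hz' : z ≠ 0 := hz.ne'
  let D : Fin (n - 1) → (Fin (2 * n) → ℝ) → Fin (2 * n) → ℝ := fun k w t =>
    nab n hn z β x σ k w ((Equiv.ofBijective _ (idx_bij n hn)).symm t)
  have hD : ∀ k w s, D k w (idx n hn s) = nab n hn z β x σ k w s := by
    intro k w s
    simp only [D]
    congr 1
    exact Equiv.symm_apply_apply (Equiv.ofBijective _ (idx_bij n hn)) s
  have hN : ∀ k w, nabla n S (Y k) w = D k w := fun k w =>
    nabla_eq n hn p β x σ hβ hσ hz k w (D k w) (hD k w)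
  have hX : ∀ k w, D k w (iX n hn) = _ := fun k w => hD k w (.inl ())
  have hY : ∀ k w l, D k w (iY n l) = _ := fun k w l => hD k w (.inr (.inl l))
  have hZ : ∀ k w l, D k w (iZ n l) = _ := fun k w l => hD k w (.inr (.inr (.inl l)))
  have hW : ∀ k w, D k w (iW n hn) = _ := fun k w => hD k w (.inr (.inr (.inr ())))
  simp only [nab] at hX hY hZ hW
  have hb : bracket n (Y i) (Y j) = 0 := by
    change bracket n (Pi.single (iY n i) 1) (Pi.single (iY n j) 1) = 0
    apply ext_idx n hn
    · simp [br_X]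
    · intro l; simp [br_Y n hn, Pi.single_apply, XY]
    · intro l; simp [br_Z n hn, Pi.single_apply, XY]
    · simp [br_W, Pi.single_apply, XY, ZY]
  have h0 : ∀ w, nabla n S 0 w = 0 := by
    intro w
    have : koszul n S 0 w = 0 := by
      funext t
      simp [koszul, ip, bracket, dotProduct]
    simp [nabla, this]
  have ipY : ∀ k w, ip n S (Y k) w = x k * w (iX n hn) + σ k * w (iY n k) := by
    intro k w
    change ip n (Sform n p x σ β) (Pi.single (iY n k) 1) w = _
    rw [ip_eq n hn]
    simp [Pi.single_apply, YX, XY, ZX, XZ, WX, XW, YZ, ZY, YW, WY, ZW, WZ, YY, ZZ]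
    ring
  have ipZ : ∀ k w, ip n S (Z k) w = σ k * w (iZ n k) := by
    intro k w
    change ip n (Sform n p x σ β) (Pi.single (iZ n k) 1) w = _
    rw [ip_eq n hn]
    simp [Pi.single_apply, YX, XY, ZX, XZ, WX, XW, YZ, ZY, YW, WY, ZW, WZ, YY, ZZ]
  have eY : ∀ k, Y k = Pi.single (iY n k) 1 := fun k => rfl
  have eZ : ∀ k, Z k = Pi.single (iZ n k) 1 := fun k => rfl
  funext w
  rw [curv, hb, h0, hN, hN, hN, hN]
  simp only [wedge, Pi.sub_apply, Pi.smul_apply, ipY, ipZ]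
  have hs : ∀ a b, x a * D b w (iX n hn) + σ a * D b w (iY n a)
      = -(w (iX n hn) * (if a = b then σ a else 0)) / 2 := by
    intro a b
    have := (hσ a).ne'
    rw [hX, hY]
    split_ifs <;> field_simp <;> ring
  by_cases hij : i = j
  · subst hij
    simp
  have hji : j ≠ i := fun h => hij h.symm
  apply ext_idx n hn
  · simp [eY, eZ, Pi.single_apply, hX i (D j w), hX j (D i w), hs, hij, hji, XY, XZ]
  · intro l
    simp [eY, eZ, Pi.single_apply, hY i, hY j, hs, hij, hji, YY, YZ]
    rw [hX, hX]
    split_ifs <;> field_simp <;> ring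
  · intro l
    simp [eY, eZ, Pi.single_apply, hZ i, hZ j, hij, hji, ZZ, ZY]
    rw [hW, hW]
    split_ifs <;> field_simp <;> ring
  · simp [eY, eZ, Pi.single_apply, hW i, hW j, hij, hji, WZ, WY]
    rw [hZ, hZ]
    simp [hij, hji]

end CHn
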